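/- arXiv:2408.00233 — 4 statements merged into one kernel-verified Lean document; each statement's English description precedes it below -/
import Mathlib

section
/- Let B = A(E ⊕ E, ψ) be the twisted group algebra of E ⊕ E with the form ⟨(x,y),(x',y')⟩ := ⟨x,x'⟩ + ⟨y,y'⟩ (which is again nondegenerate and alternating), with basis elements written [x,y]. Assume γ ∈ k is nonzero and γ² = |E|·1_k (so in particular the cardinality |E| is nonzero in k), and set π := γ⁻¹ · Σ_{u ∈ E} [u, −u] ∈ B. Then π·π = [0,0] (the unit of B), and for all x, y ∈ E one has π·[x,y]·π = [y,x]; that is, conjugation by π is the swap of the two tensor factors of A(E, ψ) ⊗ A(E, ψ) ≅ B. -/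
/-!
STATEMENT 11: In the twisted group algebra B = A(E ⊕ E, ψ) with the sum form,
the element π = γ⁻¹ · Σ_{u ∈ E} [u, −u] (where γ² = |E|, γ ≠ 0) satisfies
π·π = [0,0] and π·[x,y]·π = [y,x]; conjugation by π is the swap of factors.
-/

open Finsupp

/-- The twisted multiplication on the free `k`-module on a vector space `V`
(with a form `Bf`), determined by `[x]·[y] = ψ(Bf x y)·[x+y]`. -/
noncomputable def tgmul {F k V : Type*} [Field F] [Field k] [AddCommGroup V]
    (ψ : AddChar F k) (Bf : V → V → F) (a b : V →₀ k) : V →₀ k :=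
  a.sum fun x cx => b.sum fun y cy => Finsupp.single (x + y) (cx * cy * ψ (Bf x y))

lemma tgmul_sum_single {F k V ι κ : Type*} [Field F] [Field k] [AddCommGroup V]
    (ψ : AddChar F k) (Bf : V → V → F) (s : Finset ι) (t : Finset κ)
    (f : ι → V) (a : ι → k) (g : κ → V) (b : κ → k) :
    tgmul ψ Bf (∑ i ∈ s, Finsupp.single (f i) (a i)) (∑ j ∈ t, Finsupp.single (g j) (b j)) =
      ∑ i ∈ s, ∑ j ∈ t,
        Finsupp.single (f i + g j) (a i * b j * ψ (Bf (f i) (g j))) := by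
  unfold tgmul
  rw [← Finsupp.sum_finsetSum_index (fun x => by simp)
    (fun x c d => by simp [add_mul, Finsupp.sum_add])]
  refine Finset.sum_congr rfl fun i _ => ?_
  rw [Finsupp.sum_single_index (by simp), ← Finsupp.sum_finsetSum_index (fun y => by simp)
    (fun y c d => by simp [mul_add, add_mul])]
  exact Finset.sum_congr rfl fun j _ => Finsupp.sum_single_index (by simp)

/-- Orthogonality of the characters `u ↦ ψ (2 * B u z)` for a nondegenerate alternating form. -/
lemma sum_addChar_two_mul_form {F k E : Type*} [Field F] [Fintype F] [Field k]
    [AddCommGroup E] [Module F E] [Fintype E] [DecidableEq E]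
    (hodd : Odd (Fintype.card F)) (B : E →ₗ[F] E →ₗ[F] F) (halt : ∀ x : E, B x x = 0)
    (hnd : ∀ x : E, (∀ y : E, B x y = 0) → x = 0)
    (ψ : AddChar F k) (hψ : ∃ a : F, ψ a ≠ 1) (z : E) :
    ∑ u : E, ψ (2 * B u z) = if z = 0 then (Fintype.card E : k) else 0 := by
  split_ifs with hz
  · simp [hz]
  have h2 : (2 : F) ≠ 0 := Ring.two_ne_zero fun h => by
    have := FiniteField.even_card_of_char_two h
    rw [Nat.odd_iff] at hodd
    omega
  obtain ⟨a, ha⟩ := hψ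
  obtain ⟨y, hy⟩ : ∃ y, B z y ≠ 0 := by
    by_contra! h
    exact hz (hnd z h)
  have hyz : B y z ≠ 0 := by
    rw [← LinearMap.IsAlt.neg halt z y]
    exact neg_ne_zero.mpr hy
  let χ : AddChar E k := ψ.compAddMonoidHom ((2 : F) • B.flip z).toAddMonoidHom
  have hχ : χ ≠ 0 := by
    intro h
    have h' := DFunLike.congr_fun h ((a / (2 * B y z)) • y)
    apply ha
    have e : a / (2 * B y z) * (2 * B y z) = a := by field_simp
    simpa [χ, e] using h'
  simpa [χ] using AddChar.sum_eq_zero_of_ne_one hχ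

lemma tgmul_conj_antidiagonal {F k E : Type*} [Field F] [Fintype F] [Field k]
    [AddCommGroup E] [Module F E] [Fintype E]
    (hodd : Odd (Fintype.card F)) (B : E →ₗ[F] E →ₗ[F] F) (halt : ∀ x : E, B x x = 0)
    (hnd : ∀ x : E, (∀ y : E, B x y = 0) → x = 0)
    (ψ : AddChar F k) (hψ : ∃ a : F, ψ a ≠ 1)
    (γ : k) (hγ0 : γ ≠ 0) (hγ : γ ^ 2 = (Fintype.card E : k)) (x y : E) :
    tgmul ψ (fun p q : E × E => B p.1 q.1 + B p.2 q.2)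
      (∑ u : E, Finsupp.single (u + x, -u + y) (γ⁻¹ * ψ (B u x + B (-u) y)))
      (∑ u : E, Finsupp.single (u, -u) γ⁻¹) = Finsupp.single (y, x) (1 : k) := by
  classical
  rw [tgmul_sum_single]
  have hterm : ∀ u w : E,
      γ⁻¹ * ψ (B u x + B (-u) y) * γ⁻¹ *
          ψ (B (u + x) (w - u) + B (-u + y) (-(w - u))) =
        γ⁻¹ ^ 2 * ψ (B (x - y) w) * ψ (2 * B u (w - (y - x))) := by
    intro u w
    have hx := LinearMap.IsAlt.neg halt u x
    have hy := LinearMap.IsAlt.neg halt u y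
    rw [mul_assoc (γ⁻¹ ^ 2), ← AddChar.map_add_eq_mul]
    have e : B (x - y) w + 2 * B u (w - (y - x)) =
        (B u x + B (-u) y) + (B (u + x) (w - u) + B (-u + y) (-(w - u))) := by
      simp only [map_add, map_sub, map_neg, LinearMap.add_apply, LinearMap.sub_apply,
        LinearMap.neg_apply, halt, ← hx, ← hy]
      ring
    rw [e, AddChar.map_add_eq_mul ψ (B u x + B (-u) y)]
    ring
  calc
    _ = ∑ u : E, ∑ w : E, Finsupp.single (w + x, y - w)
          (γ⁻¹ ^ 2 * ψ (B (x - y) w) * ψ (2 * B u (w - (y - x)))) := by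
      refine Finset.sum_congr rfl fun u _ => ?_
      rw [← Equiv.sum_comp (Equiv.subRight u)]
      refine Finset.sum_congr rfl fun w _ => ?_
      simp only [Equiv.subRight_apply]
      rw [hterm, Prod.mk_add_mk]
      congr 2 <;> abel
    _ = ∑ w : E, Finsupp.single (w + x, y - w)
          (γ⁻¹ ^ 2 * ψ (B (x - y) w) * if w = y - x then γ ^ 2 else 0) := by
      rw [Finset.sum_comm]
      refine Finset.sum_congr rfl fun w _ => ?_
      rw [← Finsupp.single_finsetSum, ← Finset.mul_sum,
        sum_addChar_two_mul_form hodd B halt hnd ψ hψ, hγ]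
      simp only [sub_eq_zero]
    _ = _ := by
      rw [Finset.sum_eq_single (y - x) (fun w _ hw => by simp [hw]) (by simp)]
      have e : B (x - y) (y - x) = 0 := by
        rw [← neg_sub x y, map_neg, halt, neg_zero]
      rw [e, if_pos rfl, AddChar.map_zero_eq_one, mul_one, ← mul_pow, inv_mul_cancel₀ hγ0,
        one_pow, sub_add_cancel, sub_sub_cancel]

/-- In the twisted group algebra `B = A(E ⊕ E, ψ)` of `E ⊕ E`, with the form
`⟨(x,y),(x',y')⟩ = ⟨x,x'⟩ + ⟨y,y'⟩` (again alternating and nondegenerate), and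
`π := γ⁻¹ Σ_{u ∈ E} [u,−u]` where `γ ≠ 0` and `γ² = |E|`, one has
`π·π = [0,0]` and `π·[x,y]·π = [y,x]` for all `x, y ∈ E`. -/
theorem twistedGroupAlgebra_pi_conjugation
    {F k E : Type*} [Field F] [Fintype F] [Field k]
    [AddCommGroup E] [Module F E] [FiniteDimensional F E] [Fintype E]
    (hodd : Odd (Fintype.card F))
    (B : E →ₗ[F] E →ₗ[F] F)
    (halt : ∀ x : E, B x x = 0)
    (hnd : ∀ x : E, (∀ y : E, B x y = 0) → x = 0)
    (ψ : AddChar F k) (hψ : ∃ a : F, ψ a ≠ 1)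
    (γ : k) (hγ0 : γ ≠ 0) (hγ : γ ^ 2 = (Fintype.card E : k)) :
    -- the sum form on E ⊕ E
    letI B2 : E × E → E × E → F := fun p q => B p.1 q.1 + B p.2 q.2
    letI π : (E × E) →₀ k := γ⁻¹ • ∑ u : E, Finsupp.single ((u, -u) : E × E) (1 : k)
    (∀ p : E × E, B2 p p = 0) ∧
    (∀ p : E × E, (∀ q : E × E, B2 p q = 0) → p = 0) ∧
    tgmul ψ B2 π π = Finsupp.single ((0, 0) : E × E) (1 : k) ∧
    (∀ x y : E,
      tgmul ψ B2 (tgmul ψ B2 π (Finsupp.single ((x, y) : E × E) (1 : k))) π =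
        Finsupp.single ((y, x) : E × E) (1 : k)) := by
  set B2 : E × E → E × E → F := fun p q => B p.1 q.1 + B p.2 q.2
  set π : (E × E) →₀ k := γ⁻¹ • ∑ u : E, Finsupp.single ((u, -u) : E × E) (1 : k) with hπdef
  have hπ : π = ∑ u : E, Finsupp.single (u, -u) γ⁻¹ := by
    simp [hπdef, Finset.smul_sum]
  have hmul : ∀ x y : E, tgmul ψ B2 π (Finsupp.single (x, y) 1) =
      ∑ u : E, Finsupp.single (u + x, -u + y) (γ⁻¹ * ψ (B u x + B (-u) y)) := by
    intro x y
    simpa [hπ, B2] using tgmul_sum_single ψ B2 Finset.univ {()} (fun u : E => (u, -u))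
      (fun _ => γ⁻¹) (fun _ => (x, y)) (fun _ => 1)
  have hconj := tgmul_conj_antidiagonal hodd B halt hnd ψ hψ γ hγ0 hγ
  refine ⟨fun p => by simp [B2, halt], fun p hp => ?_, ?_, fun x y => ?_⟩
  · refine Prod.ext (hnd _ fun y => ?_) (hnd _ fun y => ?_)
    · simpa [B2] using hp (y, 0)
    · simpa [B2] using hp (0, y)
  · simpa [hπ, B2] using hconj 0 0
  · rw [hmul, hπ]
    exact hconj x y
end

section
/- Let B = A(E ⊕ E, ψ) with the form ⟨(x,y),(x',y')⟩ := ⟨x,x'⟩ + ⟨y,y'⟩, basis [x,y], let γ ∈ k be nonzero with γ² = |E|·1_k, and set π := γ⁻¹ · Σ_{u ∈ E} [u, −u] ∈ B. Let ε : A(E, ψ) → k be the k-linear map with ε([x]) = γ if x = 0 and ε([x]) = 0 otherwise, and let (id ⊗ ε) : B → A(E, ψ) be the k-linear map with (id ⊗ ε)([x,y]) = ε([y])·[x]. Then for all x, y ∈ E: (id ⊗ ε)([x,y]·π) = ψ(⟨x,y⟩)·[x+y]. (Together with the identity π·[x,y]·π = [y,x], this says that (π, ε) is an S-structure on the twisted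 group algebra A(E, ψ), of degree ε([0]) = γ.) -/
/-!
STATEMENT 12: With π = γ⁻¹ Σ_u [u,−u] in B = A(E ⊕ E, ψ) and ε([x]) = γ·δ_{x,0},
one has (id ⊗ ε)([x,y]·π) = ψ(⟨x,y⟩)·[x+y]; together with π·[x,y]·π = [y,x]
this says (π, ε) is an S-structure on A(E, ψ) of degree γ.
-/

open Finsupp

/-- With `π := γ⁻¹ Σ_{u ∈ E} [u,−u]` in `B = A(E ⊕ E, ψ)`, `ε([x]) = γ·δ_{x,0}`,
and `(id ⊗ ε)([x,y]) = ε([y])·[x]`, one has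
`(id ⊗ ε)([x,y]·π) = ψ(⟨x,y⟩)·[x+y]` for all `x, y ∈ E`. -/
theorem twistedGroupAlgebra_sStructure_mul
    {F k E : Type*} [Field F] [Fintype F] [Field k]
    [AddCommGroup E] [Module F E] [FiniteDimensional F E] [Fintype E]
    (hodd : Odd (Fintype.card F))
    (B : E →ₗ[F] E →ₗ[F] F)
    (halt : ∀ x : E, B x x = 0)
    (hnd : ∀ x : E, (∀ y : E, B x y = 0) → x = 0)
    (ψ : AddChar F k) (hψ : ∃ a : F, ψ a ≠ 1)
    (γ : k) (hγ0 : γ ≠ 0) (hγ : γ ^ 2 = (Fintype.card E : k)) :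
    letI B2 : E × E → E × E → F := fun p q => B p.1 q.1 + B p.2 q.2
    letI π : (E × E) →₀ k := γ⁻¹ • ∑ u : E, Finsupp.single ((u, -u) : E × E) (1 : k)
    -- (id ⊗ ε), where ε([x]) = γ if x = 0 and 0 otherwise
    letI idEps : ((E × E) →₀ k) → (E →₀ k) := fun b =>
      haveI := Classical.decEq E
      b.sum fun p c => Finsupp.single p.1 (c * (if p.2 = (0 : E) then γ else 0))
    ∀ x y : E,
      idEps (tgmul ψ B2 (Finsupp.single ((x, y) : E × E) (1 : k)) π) =
        Finsupp.single (x + y) (ψ (B x y)) := by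
  intro x y
  classical
  have hsum : (γ⁻¹ • ∑ u : E, Finsupp.single ((u, -u) : E × E) (1 : k)) =
      ∑ u : E, Finsupp.single ((u, -u) : E × E) γ⁻¹ := by
    simp [Finset.smul_sum]
  have hmul : tgmul ψ (fun p q : E × E => B p.1 q.1 + B p.2 q.2)
      (Finsupp.single ((x, y) : E × E) (1 : k))
      (γ⁻¹ • ∑ u : E, Finsupp.single ((u, -u) : E × E) (1 : k)) =
      ∑ u : E, Finsupp.single ((x + u, y - u) : E × E) (γ⁻¹ * ψ (B x u - B y u)) := by
    rw [hsum, tgmul, Finsupp.sum_single_index (by simp),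
      ← Finsupp.sum_finsetSum_index (by simp)
        (by intro a b c; rw [← Finsupp.single_add]; congr 1; ring)]
    refine Finset.sum_congr rfl fun u _ => ?_
    rw [Finsupp.sum_single_index (by simp)]
    simp [sub_eq_add_neg]
  beta_reduce
  rw [hmul, ← Finsupp.sum_finsetSum_index (by simp)
    (by intro a b c; rw [← Finsupp.single_add]; congr 1; ring),
    Finset.sum_eq_single y]
  · rw [Finsupp.sum_single_index (by simp)]
    simp only [sub_self, if_true, halt, sub_zero]
    congr 1
    field_simp
  · intro u _ hu
    rw [Finsupp.sum_single_index (by simp)]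
    simp [sub_eq_zero, hu.symm]
  · simp
end

section
/- Let u = (u₁, u₂) and v = (v₁, v₂) in F × F satisfy u₁² + u₂² = −1, v₁² + v₂² = −1, and u₁v₁ + u₂v₂ = 0. Define T : E ⊕ E → E ⊕ E by T(x, y) = (u₁x + v₁y, u₂x + v₂y). Then T is F-linear and, for the form ⟨(x,y),(x',y')⟩ := ⟨x,x'⟩ + ⟨y,y'⟩ on E ⊕ E, one has ⟨T(x,y), T(x',y')⟩ = −⟨(x,y),(x',y')⟩ for all (x,y), (x',y') ∈ E ⊕ E. Consequently T is bijective, and the k-linear map σ : A(E⊕E, ψ) → A(E⊕E, ψ) determined by σ([z]) = [T(z)] is a k-algebra anti-automorphism of the twisted group algebra A(E⊕E, ψ): σ([z]·[w]) = σ([w])·σ([z]) for all z, w ∈ E ⊕ E. -/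
/-!
STATEMENT 14: Given u, v ∈ F × F with u·u = v·v = −1 and u·v = 0, the map
T(x,y) = (u₁x + v₁y, u₂x + v₂y) on E ⊕ E is F-linear, negates the sum form,
is bijective, and [z] ↦ [T(z)] is an algebra anti-automorphism of A(E ⊕ E, ψ).
-/

open Finsupp

/-- An additive map that swaps the arguments of the form induces an anti-homomorphism of the
twisted group algebra. -/
theorem mapDomain_tgmul {F k V : Type*} [Field F] [Field k] [AddCommGroup V]
    (ψ : AddChar F k) (Bf : V → V → F) (T : V → V) (hadd : ∀ x y, T (x + y) = T x + T y)
    (hswap : ∀ x y, Bf (T y) (T x) = Bf x y) (a b : V →₀ k) :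
    Finsupp.mapDomain T (tgmul ψ Bf a b) =
      tgmul ψ Bf (Finsupp.mapDomain T b) (Finsupp.mapDomain T a) := by
  unfold tgmul
  simp_rw [Finsupp.mapDomain_sum, Finsupp.mapDomain_single]
  rw [Finsupp.sum_mapDomain_index (by simp)
    (by intros; simp only [add_mul, Finsupp.single_add, Finsupp.sum_add])]
  rw [Finsupp.sum_comm]
  refine Finsupp.sum_congr fun y _ => ?_
  rw [Finsupp.sum_mapDomain_index (by simp) (by intros; simp only [mul_add, add_mul,
    Finsupp.single_add])]
  refine Finsupp.sum_congr fun x _ => ?_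
  rw [hadd, hswap, add_comm (T x), mul_comm (a x)]

/-- For `u, v ∈ F²` with `u·u = v·v = −1` and `u·v = 0`, the map
`T(x,y) = (u₁x + v₁y, u₂x + v₂y)` is `F`-linear, satisfies
`⟨T p, T q⟩ = −⟨p, q⟩` for the sum form on `E ⊕ E`, is bijective, and induces a
`k`-algebra anti-automorphism `[z] ↦ [T z]` of the twisted group algebra
`A(E ⊕ E, ψ)`. -/
theorem twistedGroupAlgebra_antiAutomorphism_general
    {F k E : Type*} [Field F] [Fintype F] [Field k]
    [AddCommGroup E] [Module F E] [FiniteDimensional F E]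
    (hodd : Odd (Fintype.card F))
    (B : E →ₗ[F] E →ₗ[F] F)
    (halt : ∀ x : E, B x x = 0)
    (hnd : ∀ x : E, (∀ y : E, B x y = 0) → x = 0)
    (ψ : AddChar F k) (hψ : ∃ a : F, ψ a ≠ 1)
    (u v : F × F)
    (hu : u.1 ^ 2 + u.2 ^ 2 = -1)
    (hv : v.1 ^ 2 + v.2 ^ 2 = -1)
    (huv : u.1 * v.1 + u.2 * v.2 = 0) :
    letI B2 : E × E → E × E → F := fun p q => B p.1 q.1 + B p.2 q.2
    letI T : E × E → E × E := fun p =>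
      (u.1 • p.1 + v.1 • p.2, u.2 • p.1 + v.2 • p.2)
    IsLinearMap F T ∧
    (∀ p q : E × E, B2 (T p) (T q) = -B2 p q) ∧
    Function.Bijective T ∧
    (∀ a b : (E × E) →₀ k,
      Finsupp.mapDomain T (tgmul ψ B2 a b) =
        tgmul ψ B2 (Finsupp.mapDomain T b) (Finsupp.mapDomain T a)) := by
  let B2 : E × E → E × E → F := fun p q => B p.1 q.1 + B p.2 q.2
  let T : E × E → E × E := fun p => (u.1 • p.1 + v.1 • p.2, u.2 • p.1 + v.2 • p.2)
  have hlin : IsLinearMap F T := by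
    constructor
    · intro p q
      ext <;> simp only [T, Prod.fst_add, Prod.snd_add] <;> module
    · intro c p
      ext <;> simp only [T, Prod.smul_fst, Prod.smul_snd] <;> module
  have hneg : ∀ p q : E × E, B2 (T p) (T q) = -B2 p q := by
    intro p q
    simp only [B2, T, map_add, map_smul, LinearMap.add_apply, LinearMap.smul_apply, smul_eq_mul]
    linear_combination B p.1 q.1 * hu + B p.2 q.2 * hv + (B p.1 q.2 + B p.2 q.1) * huv
  have hskew : ∀ p q : E × E, B2 q p = -B2 p q := by
    intro p q
    have hB : B.IsAlt := halt
    simp only [B2]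
    rw [← hB.neg q.1 p.1, ← hB.neg q.2 p.2]
    ring
  have hinj : Function.Injective T := by
    refine Function.LeftInverse.injective
      (g := fun p => (-(u.1 • p.1 + u.2 • p.2), -(v.1 • p.1 + v.2 • p.2))) fun p => ?_
    ext
    · simp only [T]
      match_scalars
      · linear_combination -hu
      · linear_combination -huv
    · simp only [T]
      match_scalars
      · linear_combination -huv
      · linear_combination -hv
  refine ⟨hlin, hneg, ⟨hinj, ?_⟩, fun a b => ?_⟩
  · exact LinearMap.surjective_of_injective (f := hlin.mk' T) hinj
  · exact mapDomain_tgmul ψ B2 T hlin.map_add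
      (fun x y => by rw [hneg, hskew x y, neg_neg]) a b
end

section
/- Let Γ be a group, let V and W be finite-dimensional complex vector spaces, and let ρ : Γ → GL(V) and σ : Γ → GL(W) be representations. Suppose φ : End_ℂ(V) → End_ℂ(W) is an isomorphism of ℂ-algebras that is Γ-equivariant: φ(ρ(g) ∘ f ∘ ρ(g)⁻¹) = σ(g) ∘ φ(f) ∘ σ(g)⁻¹ for all g ∈ Γ and f ∈ End_ℂ(V). Then there exist a group homomorphism λ : Γ → ℂˣ and a ℂ-linear isomorphism ψ : V → W such that ρ(g) = λ(g) • (ψ⁻¹ ∘ σ(g) ∘ ψ) for all g ∈ Γ; equivalently, V is isomorphic as a representation of Γ to L ⊗ W, where L is the one-dimensional representation given by λ. -/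
/-!
STATEMENT 16: If ρ, σ are finite-dimensional complex representations of a group
Γ and φ : End(V) → End(W) is a Γ-equivariant ℂ-algebra isomorphism, then there
are a character λ : Γ → ℂˣ and a linear isomorphism ψ : V → W with
ρ(g) = λ(g) • (ψ⁻¹ ∘ σ(g) ∘ ψ) for all g; i.e. V ≅ L ⊗ W as representations.
-/

open Module

/-- Two homomorphisms into the unit group of a central algebra over a field which induce the same
action by conjugation differ by a character. -/
theorem exists_character_of_conj_eq {G K A : Type*} [Group G] [Field K] [Ring A] [Algebra K A]
    [Algebra.IsCentral K A] (r s : G →* Aˣ)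
    (h : ∀ (g : G) (a : A), ↑(r g) * a * ↑(r g)⁻¹ = ↑(s g) * a * ↑(s g)⁻¹) :
    ∃ lam : G →* Kˣ, ∀ g, (r g : A) = (lam g : K) • (s g : A) := by
  cases subsingleton_or_nontrivial A with
  | inl _ => exact ⟨1, fun _ ↦ Subsingleton.elim _ _⟩
  | inr _ =>
    have exists_scalar (g : G) : ∃ c : K, (r g : A) = c • (s g : A) := by
      have hmem : (↑(s g)⁻¹ * ↑(r g) : A) ∈ Subalgebra.center K A := by
        rw [Subalgebra.mem_center_iff]
        intro a
        have hg := congr(↑(s g)⁻¹ * $(h g a) * (r g : A))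
        simp only [mul_assoc, Units.inv_mul, mul_one, Units.inv_mul_cancel_left] at hg
        rw [mul_assoc, hg]
      rw [Algebra.IsCentral.center_eq_bot, Algebra.mem_bot] at hmem
      obtain ⟨c, hc⟩ := hmem
      refine ⟨c, ?_⟩
      rw [Algebra.smul_def, Algebra.commutes, hc, Units.mul_inv_cancel_left]
    choose c hc using exists_scalar
    have eq_of_smul {g : G} {a b : K} (hab : a • (s g : A) = b • (s g : A)) : a = b :=
      smul_left_injective K (s g).ne_zero hab
    let lam : G →* K :=
      { toFun := c
        map_one' := eq_of_smul (g := 1) (by rw [← hc, map_one, map_one, one_smul])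
        map_mul' := fun g k ↦ eq_of_smul (g := g * k) (by
          rw [← hc, map_mul, map_mul, Units.val_mul, Units.val_mul, hc g, hc k,
            smul_mul_smul_comm]) }
    exact ⟨lam.toHomUnits, hc⟩

/-- If `φ : End(V) ≃ₐ End(W)` is a `Γ`-equivariant isomorphism of
endomorphism algebras of finite-dimensional complex representations
`ρ : Γ →* GL(V)`, `σ : Γ →* GL(W)`, then there exist a group homomorphism
`λ : Γ → ℂˣ` and a linear isomorphism `ψ : V ≃ W` with
`ρ(g) = λ(g) • (ψ⁻¹ ∘ σ(g) ∘ ψ)` for all `g ∈ Γ`. -/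
theorem equivariant_endAlgebra_iso_twist
    {G : Type*} [Group G]
    {V W : Type*} [AddCommGroup V] [Module ℂ V] [FiniteDimensional ℂ V]
    [AddCommGroup W] [Module ℂ W] [FiniteDimensional ℂ W]
    (ρ : G →* (Module.End ℂ V)ˣ) (σ : G →* (Module.End ℂ W)ˣ)
    (φ : Module.End ℂ V ≃ₐ[ℂ] Module.End ℂ W)
    (hequiv : ∀ (g : G) (f : Module.End ℂ V),
      φ (↑(ρ g) * f * ↑(ρ g)⁻¹) = ↑(σ g) * φ f * ↑(σ g)⁻¹) :
    ∃ (lam : G →* ℂˣ) (ψ : V ≃ₗ[ℂ] W),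
      ∀ g : G,
        (↑(ρ g) : Module.End ℂ V) =
          (lam g : ℂ) •
            (ψ.symm.toLinearMap ∘ₗ (↑(σ g) : Module.End ℂ W) ∘ₗ ψ.toLinearMap) := by
  obtain ⟨ψ, rfl⟩ := φ.eq_linearEquivConjAlgEquiv
  let e := (ψ.conjAlgEquiv ℂ).symm
  obtain ⟨lam, hlam⟩ := exists_character_of_conj_eq (K := ℂ) ρ
    ((Units.map (e : Module.End ℂ W →* Module.End ℂ V)).comp σ) fun g f ↦ by
      apply (ψ.conjAlgEquiv ℂ).injective
      rw [hequiv, MonoidHom.comp_apply, ← map_inv, map_mul, map_mul]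
      simp [e, ← map_inv]
  exact ⟨lam, ψ, hlam⟩
end
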